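/- (Theorem 1, necessary optimality conditions for polar scheduling.) Let V ≥ 2 and let π* = (s_1, …, s_V) be a detecting order that maximizes Θ_π over all V! detecting orders. Then for every k with 1 ≤ k ≤ V−1 such that s_k and s_{k+1} share at least one resource (ℱ_{s_k} ∩ ℱ_{s_{k+1}} ≠ ∅), one has γ_{s_k}^{(D_{k−1})} ≤ γ_{s_{k+1}}^{(D_{k−1})}. -/

import Mathlib

open Finset

/-- The set of resources connected to user `v` in the factor graph `A`. -/
def Fv {F V : ℕ} (A : Fin F → Fin V → Bool) (v : Fin V) : Finset (Fin F) :=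
  Finset.univ.filter (fun f => A f v = true)

/-- The degree `d_f` of resource `f`: the number of users connected to it. -/
def deg {F V : ℕ} (A : Fin F → Fin V → Bool) (f : Fin F) : ℕ :=
  (Finset.univ.filter (fun v => A f v = true)).card

/-- The pruned degree `d_f^{(D)}` of resource `f` after the users in `D` are detected. -/
def prunedDeg {F V : ℕ} (A : Fin F → Fin V → Bool) (D : Finset (Fin V)) (f : Fin F) : ℕ :=
  (Finset.univ.filter (fun v => v ∉ D ∧ A f v = true)).card

/-- The instantaneous SINR `γ_v^{(D)}` of an undetected user `v`. -/
noncomputable def gamma {F V : ℕ} (lam : ℝ) (A : Fin F → Fin V → Bool)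
    (D : Finset (Fin V)) (v : Fin V) : ℝ :=
  ∑ f ∈ Fv A v, 1 / (((prunedDeg A D f : ℝ) - 1) + lam)

/-- The detected set `D_{k-1} = {s_1, …, s_{k-1}}` of users occupying positions before `k`
in the detecting order `π` (position `k` maps to user `π k`). -/
def Dset {V : ℕ} (π : Equiv.Perm (Fin V)) (k : Fin V) : Finset (Fin V) :=
  (Finset.univ.filter (fun j => j < k)).image π

/-- The detecting SINR `γ_{s_k} = γ_{s_k}^{(D_{k-1})}` at position `k` of the order `π`. -/
noncomputable def detSINR {F V : ℕ} (lam : ℝ) (A : Fin F → Fin V → Bool)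
    (π : Equiv.Perm (Fin V)) (k : Fin V) : ℝ :=
  gamma lam A (Dset π k) (π k)

/-- `Θ_π`, the sum of squared detecting SINRs. -/
noncomputable def Theta {F V : ℕ} (lam : ℝ) (A : Fin F → Fin V → Bool)
    (π : Equiv.Perm (Fin V)) : ℝ :=
  ∑ k : Fin V, (detSINR lam A π k) ^ 2

/-- `M_π`, the mean of the detecting SINR sequence. -/
noncomputable def Mmean {F V : ℕ} (lam : ℝ) (A : Fin F → Fin V → Bool)
    (π : Equiv.Perm (Fin V)) : ℝ :=
  (1 / (V : ℝ)) * ∑ k : Fin V, detSINR lam A π k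

/-- `V_π`, the variance of the detecting SINR sequence. -/
noncomputable def Vπ {F V : ℕ} (lam : ℝ) (A : Fin F → Fin V → Bool)
    (π : Equiv.Perm (Fin V)) : ℝ :=
  (1 / (V : ℝ)) * (∑ k : Fin V, (detSINR lam A π k) ^ 2) - (Mmean lam A π) ^ 2

/-- Detecting `u` lowers the pruned degree by one exactly on the resources of `u`. -/
theorem prunedDeg_insert_add {F V : ℕ} (A : Fin F → Fin V → Bool) {D : Finset (Fin V)}
    {u : Fin V} (hu : u ∉ D) (f : Fin F) :
    prunedDeg A (insert u D) f + (if A f u = true then 1 else 0) = prunedDeg A D f := by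
  unfold prunedDeg
  split_ifs with h
  · rw [← Finset.card_insert_of_notMem (a := u) (by simp)]
    congr 1
    ext v
    by_cases hv : v = u <;> simp_all
  · rw [add_zero]
    congr 1
    ext v
    by_cases hv : v = u <;> simp_all

/-- The swap increment `Δ`: the gain in SINR of `v` when `u` is detected, and vice versa. -/
noncomputable def swapIncrement {F V : ℕ} (lam : ℝ) (A : Fin F → Fin V → Bool)
    (D : Finset (Fin V)) (u v : Fin V) : ℝ :=
  ∑ f ∈ Fv A u ∩ Fv A v,
    (1 / (((prunedDeg A D f : ℝ) - 2) + lam) - 1 / (((prunedDeg A D f : ℝ) - 1) + lam))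

theorem swapIncrement_comm {F V : ℕ} (lam : ℝ) (A : Fin F → Fin V → Bool)
    (D : Finset (Fin V)) (u v : Fin V) :
    swapIncrement lam A D u v = swapIncrement lam A D v u := by
  unfold swapIncrement
  rw [Finset.inter_comm]

theorem gamma_insert {F V : ℕ} (lam : ℝ) (A : Fin F → Fin V → Bool) {D : Finset (Fin V)}
    {u : Fin V} (hu : u ∉ D) (v : Fin V) :
    gamma lam A (insert u D) v = gamma lam A D v + swapIncrement lam A D u v := by
  have hinter : Fv A u ∩ Fv A v = (Fv A v).filter (fun f => A f u = true) := by
    ext f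
    simp [Fv, and_comm]
  unfold gamma swapIncrement
  rw [hinter, Finset.sum_filter, ← Finset.sum_add_distrib]
  refine Finset.sum_congr rfl fun f _ => ?_
  rw [← prunedDeg_insert_add A hu f]
  split_ifs
  · push_cast
    ring_nf
  · simp

theorem two_le_prunedDeg {F V : ℕ} (A : Fin F → Fin V → Bool) {D : Finset (Fin V)}
    {u v : Fin V} (hu : u ∉ D) (hv : v ∉ D) (huv : u ≠ v) {f : Fin F}
    (hf : f ∈ Fv A u ∩ Fv A v) : 2 ≤ prunedDeg A D f := by
  simp only [Fv, Finset.mem_inter, Finset.mem_filter, Finset.mem_univ, true_and] at hf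
  rw [← Finset.card_pair huv]
  refine Finset.card_le_card fun w hw => ?_
  rcases Finset.mem_insert.mp hw with rfl | hw
  · simp [hu, hf.1]
  · rw [Finset.mem_singleton.mp hw]
    simp [hv, hf.2]

theorem swapIncrement_pos {F V : ℕ} {lam : ℝ} (hlam : 0 < lam) (A : Fin F → Fin V → Bool)
    {D : Finset (Fin V)} {u v : Fin V} (hu : u ∉ D) (hv : v ∉ D) (huv : u ≠ v)
    (hshare : (Fv A u ∩ Fv A v).Nonempty) : 0 < swapIncrement lam A D u v := by
  refine Finset.sum_pos (fun f hf => ?_) hshare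
  have hd : (2 : ℝ) ≤ prunedDeg A D f := by
    exact_mod_cast two_le_prunedDeg A hu hv huv hf
  exact sub_pos.mpr (one_div_lt_one_div_of_lt (by linarith) (by linarith))

theorem mem_Dset {V : ℕ} (π : Equiv.Perm (Fin V)) (j x : Fin V) :
    x ∈ Dset π j ↔ π.symm x < j := by
  simp only [Dset, Finset.mem_image, Finset.mem_filter, Finset.mem_univ, true_and]
  constructor
  · rintro ⟨i, hi, rfl⟩
    simpa using hi
  · exact fun h => ⟨π.symm x, h, by simp⟩

theorem Dset_of_val_eq_succ {V : ℕ} (π : Equiv.Perm (Fin V)) {k l : Fin V}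
    (hl : (l : ℕ) = k + 1) : Dset π l = insert (π k) (Dset π k) := by
  ext x
  rw [Finset.mem_insert, mem_Dset, mem_Dset, ← Equiv.symm_apply_eq, Fin.lt_def, Fin.lt_def,
    Fin.ext_iff]
  omega

/-- Swapping two consecutive positions only changes the detected set between them. -/
theorem Dset_mul_swap {V : ℕ} (π : Equiv.Perm (Fin V)) {k l j : Fin V}
    (hl : (l : ℕ) = k + 1) (hj : j ≠ l) : Dset (π * Equiv.swap k l) j = Dset π j := by
  ext x
  have hx : (π * Equiv.swap k l).symm x = Equiv.swap k l (π.symm x) := by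
    rw [Equiv.symm_apply_eq]
    simp
  rw [mem_Dset, mem_Dset, hx, Equiv.swap_apply_def]
  split_ifs <;> simp only [Fin.lt_def, Fin.ext_iff, ne_eq] at * <;> omega

/-- The change of `Θ` under a swap of two consecutive positions. -/
theorem Theta_mul_swap_sub {F V : ℕ} (lam : ℝ) (A : Fin F → Fin V → Bool)
    (π : Equiv.Perm (Fin V)) {k l : Fin V} (hl : (l : ℕ) = k + 1) :
    Theta lam A (π * Equiv.swap k l) - Theta lam A π =
      2 * swapIncrement lam A (Dset π k) (π k) (π l) *
        (gamma lam A (Dset π k) (π k) - gamma lam A (Dset π k) (π l)) := by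
  have hkl : k ≠ l := by
    rw [ne_eq, Fin.ext_iff]
    omega
  have hu : π k ∉ Dset π k := by simp [mem_Dset]
  have hv : π l ∉ Dset π k := by
    simp only [mem_Dset, Equiv.symm_apply_apply, Fin.lt_def]
    omega
  have hrest : ∀ j, j ≠ k ∧ j ≠ l →
      detSINR lam A (π * Equiv.swap k l) j ^ 2 - detSINR lam A π j ^ 2 = 0 := by
    rintro j ⟨hjk, hjl⟩
    simp [detSINR, Dset_mul_swap π hl hjl, Equiv.swap_apply_of_ne_of_ne hjk hjl]
  have hk : detSINR lam A (π * Equiv.swap k l) k = gamma lam A (Dset π k) (π l) := by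
    simp [detSINR, Dset_mul_swap π hl hkl]
  have hl₁ : detSINR lam A π l = gamma lam A (Dset π k) (π l) +
      swapIncrement lam A (Dset π k) (π k) (π l) := by
    rw [detSINR, Dset_of_val_eq_succ π hl, gamma_insert lam A hu]
  have hl₂ : detSINR lam A (π * Equiv.swap k l) l = gamma lam A (Dset π k) (π k) +
      swapIncrement lam A (Dset π k) (π k) (π l) := by
    rw [detSINR, Dset_of_val_eq_succ _ hl, Dset_mul_swap π hl hkl, Equiv.Perm.mul_apply,
      Equiv.Perm.mul_apply, Equiv.swap_apply_left, Equiv.swap_apply_right,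
      gamma_insert lam A hv, swapIncrement_comm]
  rw [Theta, Theta, ← Finset.sum_sub_distrib, Fintype.sum_eq_add k l hkl hrest, hk, hl₁, hl₂,
    detSINR]
  ring

/-- Theorem 1, necessary optimality conditions: if `π` maximizes Θ, then at
every pair of consecutive positions whose users share a resource, the first user's detecting
SINR is at most the second user's SINR (both evaluated at `D_{k−1}`). -/
theorem stmt_9 {F V : ℕ} (hV : 2 ≤ V) (lam : ℝ) (hlam : 0 < lam)
    (A : Fin F → Fin V → Bool) (π : Equiv.Perm (Fin V))
    (hmax : ∀ ρ : Equiv.Perm (Fin V), Theta lam A ρ ≤ Theta lam A π) :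
    ∀ (k : Fin V) (hk : (k : ℕ) + 1 < V),
      (Fv A (π k) ∩ Fv A (π ⟨(k : ℕ) + 1, hk⟩)).Nonempty →
      gamma lam A (Dset π k) (π k) ≤ gamma lam A (Dset π k) (π ⟨(k : ℕ) + 1, hk⟩) := by
  intro k hk hshare
  set l : Fin V := ⟨(k : ℕ) + 1, hk⟩
  have hl : (l : ℕ) = k + 1 := rfl
  have hpos : 0 < swapIncrement lam A (Dset π k) (π k) (π l) := by
    refine swapIncrement_pos hlam A ?_ ?_ (π.injective.ne ?_) hshare
    · simp [mem_Dset]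
    · simp only [mem_Dset, Equiv.symm_apply_apply, Fin.lt_def]
      omega
    · rw [ne_eq, Fin.ext_iff]
      omega
  by_contra! h
  nlinarith [hmax (π * Equiv.swap k l), Theta_mul_swap_sub lam A π hl,
    mul_pos hpos (sub_pos.mpr h)]
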